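/- arXiv:1611.06379 — 8 statements merged into one kernel-verified Lean document; each statement's English description precedes it below -/
import Mathlib

section
/- For all d, h ∈ ℝ³, the 4×4 real matrix F = F(d,h) satisfies: det F = −(d·h)², tr(F²) = 2(‖d‖² − ‖h‖²), and its characteristic polynomial equals X⁴ − (‖d‖² − ‖h‖²)·X² − (d·h)². Consequently, the complex eigenvalues of F are ±σ and ±iθ for real σ, θ satisfying σ² − θ² = ‖d‖² − ‖h‖² and σ²θ² = (d·h)². -/
open Matrix Polynomial

/-- The 4×4 `G`-skew symmetric matrix `F(d,h) = [[0, dᵀ],[d, V(h)]]`, where `V(h)` is the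
matrix of `u ↦ u × h`. -/
def Fmat (d h : Fin 3 → ℝ) : Matrix (Fin 4) (Fin 4) ℝ :=
  !![0,   d 0,    d 1,    d 2;
     d 0, 0,      h 2,    -h 1;
     d 1, -h 2,   0,      h 0;
     d 2, h 1,    -h 0,   0]

theorem Fmat_det (d h : Fin 3 → ℝ) : (Fmat d h).det = -(d ⬝ᵥ h) ^ 2 := by
  simp [Fmat, det_succ_row_zero, Fin.sum_univ_succ, dotProduct, Fin.succAbove]
  ring

theorem trace_Fmat_sq (d h : Fin 3 → ℝ) :
    ((Fmat d h) ^ 2).trace = 2 * (d ⬝ᵥ d - h ⬝ᵥ h) := by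
  simp [Fmat, pow_two, trace, Fin.sum_univ_succ, dotProduct]
  ring

theorem charpoly_Fmat (d h : Fin 3 → ℝ) :
    (Fmat d h).charpoly =
      X ^ 4 - C (d ⬝ᵥ d - h ⬝ᵥ h) * X ^ 2 - C ((d ⬝ᵥ h) ^ 2) := by
  simp [Fmat, charpoly, charmatrix_apply, det_succ_row_zero, Fin.sum_univ_succ, dotProduct,
    Fin.succAbove, diagonal_apply]
  ring

/-- There are two real squares with any prescribed difference and any prescribed nonnegative
product. -/
theorem exists_sq_sub_sq_eq_and_sq_mul_sq_eq (a b : ℝ) :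
    ∃ σ θ : ℝ, σ ^ 2 - θ ^ 2 = a ∧ σ ^ 2 * θ ^ 2 = b ^ 2 := by
  have hr : √(a ^ 2 + 4 * b ^ 2) ^ 2 = a ^ 2 + 4 * b ^ 2 := Real.sq_sqrt (by positivity)
  have ha : |a| ≤ √(a ^ 2 + 4 * b ^ 2) := Real.abs_le_sqrt (by nlinarith [sq_nonneg b])
  obtain ⟨h₁, h₂⟩ := abs_le.mp ha
  refine ⟨√((√(a ^ 2 + 4 * b ^ 2) + a) / 2), √((√(a ^ 2 + 4 * b ^ 2) - a) / 2), ?_, ?_⟩ <;>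
    rw [Real.sq_sqrt (by linarith), Real.sq_sqrt (by linarith)]
  · ring
  · linear_combination hr / 4

/-- Determinant, trace of the square, characteristic polynomial of `F(d,h)`, and the
resulting eigenvalue pattern `±σ, ±iθ` with `σ² − θ² = ‖d‖² − ‖h‖²`, `σ²θ² = (d·h)²`. -/
theorem Fmat_det_trace_charpoly_eigenvalues (d h : Fin 3 → ℝ) :
    (Fmat d h).det = -(d ⬝ᵥ h) ^ 2 ∧
    ((Fmat d h) ^ 2).trace = 2 * (d ⬝ᵥ d - h ⬝ᵥ h) ∧
    (Fmat d h).charpoly =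
      X ^ 4 - C (d ⬝ᵥ d - h ⬝ᵥ h) * X ^ 2 - C ((d ⬝ᵥ h) ^ 2) ∧
    ∃ σ θ : ℝ, σ ^ 2 - θ ^ 2 = d ⬝ᵥ d - h ⬝ᵥ h ∧ σ ^ 2 * θ ^ 2 = (d ⬝ᵥ h) ^ 2 ∧
      ((Fmat d h).map Complex.ofReal).charpoly =
        (X - C (σ : ℂ)) * (X + C (σ : ℂ)) *
          (X - C ((θ : ℂ) * Complex.I)) * (X + C ((θ : ℂ) * Complex.I)) := by
  refine ⟨Fmat_det d h, trace_Fmat_sq d h, charpoly_Fmat d h, ?_⟩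
  obtain ⟨σ, θ, hsub, hmul⟩ :=
    exists_sq_sub_sq_eq_and_sq_mul_sq_eq (d ⬝ᵥ d - h ⬝ᵥ h) (d ⬝ᵥ h)
  refine ⟨σ, θ, hsub, hmul, ?_⟩
  have hmap : ((Fmat d h).map Complex.ofReal).charpoly =
      (Fmat d h).charpoly.map Complex.ofRealHom := charpoly_map (Fmat d h) Complex.ofRealHom
  have hI : (C Complex.I : ℂ[X]) ^ 2 = -1 := by rw [← C_pow, Complex.I_sq, C_neg, C_1]
  rw [hmap, charpoly_Fmat, ← hsub, ← hmul]
  simp only [Polynomial.map_sub, Polynomial.map_mul, Polynomial.map_pow, map_X, map_C,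
    Complex.ofRealHom_eq_coe, C_sub, C_mul, C_pow]
  linear_combination (X ^ 2 - C (σ : ℂ) ^ 2) * C (θ : ℂ) ^ 2 * hI
end

section
/- For all d, h ∈ ℝ³, the matrices F = F(d,h) and its skew conjugate F̃ = F(h,−d) satisfy: (a) F·F̃ = F̃·F = (d·h)·I; (b) F² − F̃² = (‖d‖² − ‖h‖²)·I; (c) F³ = (‖d‖² − ‖h‖²)·F + (d·h)·F̃. -/
open Matrix

theorem Fmat_mul_skewConjugate (d h : Fin 3 → ℝ) :
    Fmat d h * Fmat h (-d) = (d ⬝ᵥ h) • (1 : Matrix (Fin 4) (Fin 4) ℝ) := by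
  ext i j
  fin_cases i <;> fin_cases j <;>
    simp [Fmat, Matrix.mul_apply, dotProduct, Fin.sum_univ_succ] <;> ring

theorem skewConjugate_mul_Fmat (d h : Fin 3 → ℝ) :
    Fmat h (-d) * Fmat d h = (d ⬝ᵥ h) • (1 : Matrix (Fin 4) (Fin 4) ℝ) := by
  ext i j
  fin_cases i <;> fin_cases j <;>
    simp [Fmat, Matrix.mul_apply, dotProduct, Fin.sum_univ_succ] <;> ring

theorem Fmat_sq_sub_skewConjugate_sq (d h : Fin 3 → ℝ) :
    Fmat d h ^ 2 - Fmat h (-d) ^ 2 =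
      (d ⬝ᵥ d - h ⬝ᵥ h) • (1 : Matrix (Fin 4) (Fin 4) ℝ) := by
  ext i j
  fin_cases i <;> fin_cases j <;>
    simp [Fmat, sq, dotProduct, Fin.sum_univ_succ] <;> ring

/-- Relations between `F = F(d,h)` and its skew conjugate `F̃ = F(h,−d)`:
`F·F̃ = F̃·F = (d·h)·I`, `F² − F̃² = (‖d‖² − ‖h‖²)·I`,
`F³ = (‖d‖² − ‖h‖²)·F + (d·h)·F̃`. -/
theorem Fmat_skewConjugate_relations (d h : Fin 3 → ℝ) :
    Fmat d h * Fmat h (-d) = (d ⬝ᵥ h) • (1 : Matrix (Fin 4) (Fin 4) ℝ) ∧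
    Fmat h (-d) * Fmat d h = (d ⬝ᵥ h) • (1 : Matrix (Fin 4) (Fin 4) ℝ) ∧
    (Fmat d h) ^ 2 - (Fmat h (-d)) ^ 2 =
      (d ⬝ᵥ d - h ⬝ᵥ h) • (1 : Matrix (Fin 4) (Fin 4) ℝ) ∧
    (Fmat d h) ^ 3 = (d ⬝ᵥ d - h ⬝ᵥ h) • Fmat d h + (d ⬝ᵥ h) • Fmat h (-d) := by
  refine ⟨Fmat_mul_skewConjugate d h, skewConjugate_mul_Fmat d h,
    Fmat_sq_sub_skewConjugate_sq d h, ?_⟩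
  rw [pow_succ', sub_eq_iff_eq_add.mp (Fmat_sq_sub_skewConjugate_sq d h), mul_add,
    sq (Fmat h (-d)), ← mul_assoc, Fmat_mul_skewConjugate, Matrix.mul_smul, Matrix.mul_one,
    Matrix.smul_mul, Matrix.one_mul]
end

section
/- Let F, X, Y be n×n real matrices and a, b nonzero real numbers such that F = a·X + b·Y, X·Y = Y·X = 0, X³ = −X, and Y³ = Y. Then necessarily X = (b²·F − F³)/(a(a² + b²)) and Y = (a²·F + F³)/(b(a² + b²)); in particular, X and Y are uniquely determined by F, a, b. -/
/-- Cubes are additive on linear combinations of product-orthogonal elements. -/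
theorem smul_add_smul_pow_three_of_mul_eq_zero {R A : Type*} [CommSemiring R] [Semiring A]
    [Algebra R A] {x y : A} (a b : R) (hxy : x * y = 0) (hyx : y * x = 0) :
    (a • x + b • y) ^ 3 = a ^ 3 • x ^ 3 + b ^ 3 • y ^ 3 := by
  simp [pow_succ, add_mul, mul_add, smul_smul, mul_assoc, hxy, hyx]


/-- Uniqueness of the orthogonal decomposition `F = a·X + b·Y` with `X·Y = Y·X = 0`,
`X³ = −X`, `Y³ = Y`: the components are given explicitly by
`X = (b²F − F³)/(a(a²+b²))` and `Y = (a²F + F³)/(b(a²+b²))`. -/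
theorem orthogonal_decomposition_unique {n : ℕ}
    (F X Y : Matrix (Fin n) (Fin n) ℝ) (a b : ℝ) (ha : a ≠ 0) (hb : b ≠ 0)
    (hF : F = a • X + b • Y)
    (hXY : X * Y = 0) (hYX : Y * X = 0)
    (hX3 : X ^ 3 = -X) (hY3 : Y ^ 3 = Y) :
    X = (a * (a ^ 2 + b ^ 2))⁻¹ • (b ^ 2 • F - F ^ 3) ∧
    Y = (b * (a ^ 2 + b ^ 2))⁻¹ • (a ^ 2 • F + F ^ 3) := by
  have hF3 : F ^ 3 = b ^ 3 • Y - a ^ 3 • X := by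
    rw [hF, smul_add_smul_pow_three_of_mul_eq_zero a b hXY hYX, hX3, hY3, smul_neg]
    abel
  have hab : a ^ 2 + b ^ 2 ≠ 0 := by positivity
  constructor
  · rw [eq_inv_smul_iff₀ (mul_ne_zero ha hab), hF3, hF]
    module
  · rw [eq_inv_smul_iff₀ (mul_ne_zero hb hab), hF3, hF]
    module
end

section
/- Let d, h ∈ ℝ³, F = F(d,h), and let σ, θ ∈ ℝ be admissible parameters (σ² − θ² = ‖d‖² − ‖h‖², σθ = d·h) with σ² + θ² > 0. Define X := (θ²·F + F³)/(σ² + θ²) and Y := (σ²·F − F³)/(σ² + θ²). Then F = X + Y, X·Y = Y·X = 0, X³ = σ²·X, Y³ = −θ²·Y, and both X and Y are G-skew symmetric (G Xᵀ G = −X and G Yᵀ G = −Y). -/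
open Matrix

/-- The matrix `G = diag(1,−1,−1,−1)`. -/
def Gmat : Matrix (Fin 4) (Fin 4) ℝ := Matrix.diagonal ![1, -1, -1, -1]

theorem Fmat_pow_four (d h : Fin 3 → ℝ) :
    Fmat d h ^ 4 = (d ⬝ᵥ d - h ⬝ᵥ h) • Fmat d h ^ 2 + ((d ⬝ᵥ h) ^ 2) • 1 := by
  have hsq : Fmat d h ^ 4 = (Fmat d h * Fmat d h) * (Fmat d h * Fmat d h) := by
    noncomm_ring
  rw [hsq, pow_two (Fmat d h)]
  ext i j
  fin_cases i <;> fin_cases j <;>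
    simp [Fmat, Matrix.mul_apply, Fin.sum_univ_succ, dotProduct] <;> ring

theorem Gmat_mul_self : Gmat * Gmat = 1 := by
  rw [Gmat, Matrix.diagonal_mul_diagonal, ← Matrix.diagonal_one]
  congr 1
  ext i
  fin_cases i <;> simp

theorem Gmat_mul_transpose_Fmat (d h : Fin 3 → ℝ) :
    Gmat * (Fmat d h)ᵀ * Gmat = -Fmat d h := by
  ext i j
  fin_cases i <;> fin_cases j <;> simp [Fmat, Gmat]

theorem Gmat_mul_transpose_pow_three {F : Matrix (Fin 4) (Fin 4) ℝ}
    (hF : Gmat * Fᵀ * Gmat = -F) : Gmat * (F ^ 3)ᵀ * Gmat = -F ^ 3 := by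
  calc Gmat * (F ^ 3)ᵀ * Gmat
      = Gmat * Fᵀ * 1 * Fᵀ * 1 * Fᵀ * Gmat := by
        rw [Matrix.transpose_pow]
        simp only [mul_one, pow_succ, pow_zero, one_mul, mul_assoc]
    _ = (Gmat * Fᵀ * Gmat) * (Gmat * Fᵀ * Gmat) * (Gmat * Fᵀ * Gmat) := by
        simp only [← Gmat_mul_self, mul_assoc]
    _ = -F ^ 3 := by rw [hF]; noncomm_ring

/-- Cutting `F` down by a commuting idempotent on which `F ^ 2` acts as the scalar `c`. -/
theorem mul_idempotent_pow_three {A : Type*} [Ring A] [Algebra ℝ A] {F E : A} {c : ℝ}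
    (hcomm : Commute F E) (hE : IsIdempotentElem E) (hc : F ^ 2 * E = c • E) :
    (F * E) ^ 3 = c • (F * E) := by
  rw [hcomm.mul_pow, hE.pow_succ_eq 2, pow_succ', mul_assoc, hc, mul_smul_comm]

/-- Orthogonal decomposition of a diagonalizable `G`-skew symmetric matrix:
with `X = (θ²F + F³)/(σ²+θ²)` and `Y = (σ²F − F³)/(σ²+θ²)` one has `F = X + Y`,
`XY = YX = 0`, `X³ = σ²X`, `Y³ = −θ²Y`, and `X, Y` are `G`-skew symmetric. -/
theorem orthogonal_decomposition_Fmat (d h : Fin 3 → ℝ) (σ θ : ℝ)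
    (h1 : σ ^ 2 - θ ^ 2 = d ⬝ᵥ d - h ⬝ᵥ h)
    (h2 : σ * θ = d ⬝ᵥ h)
    (h3 : 0 < σ ^ 2 + θ ^ 2) :
    ∀ F X Y : Matrix (Fin 4) (Fin 4) ℝ,
      F = Fmat d h →
      X = (σ ^ 2 + θ ^ 2)⁻¹ • (θ ^ 2 • F + F ^ 3) →
      Y = (σ ^ 2 + θ ^ 2)⁻¹ • (σ ^ 2 • F - F ^ 3) →
      F = X + Y ∧ X * Y = 0 ∧ Y * X = 0 ∧
      X ^ 3 = σ ^ 2 • X ∧ Y ^ 3 = (-(θ ^ 2)) • Y ∧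
      Gmat * Xᵀ * Gmat = -X ∧ Gmat * Yᵀ * Gmat = -Y := by
  rintro F X Y hF rfl rfl
  have hs := h3.ne'
  have hskew : Gmat * Fᵀ * Gmat = -F := hF ▸ Gmat_mul_transpose_Fmat d h
  have hskew3 := Gmat_mul_transpose_pow_three hskew
  have hF4 : F ^ 4 = (σ ^ 2 - θ ^ 2) • F ^ 2 + ((σ * θ) ^ 2) • 1 := by
    rw [h1, h2, hF, Fmat_pow_four]
  set s := σ ^ 2 + θ ^ 2 with hsdef
  set E := s⁻¹ • (θ ^ 2 • (1 : Matrix (Fin 4) (Fin 4) ℝ) + F ^ 2) with hEdef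
  have hX : s⁻¹ • (θ ^ 2 • F + F ^ 3) = F * E := by
    simp only [hEdef, mul_smul_comm, mul_add, mul_one, ← pow_succ']
  have hFE : F ^ 2 * E = σ ^ 2 • E := by
    simp only [hEdef, mul_smul_comm, mul_add, mul_one, ← pow_add, Nat.reduceAdd, hF4]
    module
  have hE : IsIdempotentElem E := by
    have hEE : E * E = s⁻¹ • (θ ^ 2 • E + F ^ 2 * E) := by
      conv_lhs => enter [1]; rw [hEdef]
      simp only [smul_mul_assoc, add_mul, one_mul]
    rw [IsIdempotentElem, hEE, hFE, ← add_smul, smul_smul, add_comm (θ ^ 2), ← hsdef,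
      inv_mul_cancel₀ hs, one_smul]
  have hcomm : Commute F E :=
    (((Commute.one_right F).smul_right _).add_right (Commute.self_pow F 2)).smul_right _
  have hsum : F = s⁻¹ • (θ ^ 2 • F + F ^ 3) + s⁻¹ • (σ ^ 2 • F - F ^ 3) := by
    have hadd : θ ^ 2 • F + F ^ 3 + (σ ^ 2 • F - F ^ 3) = s • F := by rw [hsdef]; module
    rw [← smul_add, hadd, smul_smul, inv_mul_cancel₀ hs, one_smul]
  have hY : s⁻¹ • (σ ^ 2 • F - F ^ 3) = F * (1 - E) := by
    rw [mul_sub, mul_one, ← hX]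
    exact eq_sub_of_add_eq' hsum.symm
  have hcomm' : Commute F (1 - E) := (Commute.one_right F).sub_right hcomm
  have hFE' : F ^ 2 * (1 - E) = (-(θ ^ 2)) • (1 - E) := by
    have hsE : s • E = θ ^ 2 • (1 : Matrix (Fin 4) (Fin 4) ℝ) + F ^ 2 := by
      rw [hEdef, smul_smul, mul_inv_cancel₀ hs, one_smul]
    rw [mul_sub, mul_one, hFE, eq_sub_of_add_eq' hsE.symm, hsdef]
    module
  refine ⟨hsum, ?_, ?_, ?_, ?_, ?_, ?_⟩
  · rw [hX, hY, hcomm.eq, hcomm'.eq, mul_assoc, ← mul_assoc F, hcomm'.eq, mul_assoc,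
      ← mul_assoc E, hE.mul_one_sub_self, zero_mul]
  · rw [hX, hY, hcomm.eq, hcomm'.eq, mul_assoc, ← mul_assoc F, hcomm.eq, mul_assoc,
      ← mul_assoc (1 - E), hE.one_sub_mul_self, zero_mul]
  · rw [hX]
    exact mul_idempotent_pow_three hcomm hE hFE
  · rw [hY]
    exact mul_idempotent_pow_three hcomm' hE.one_sub hFE'
  · simp only [Matrix.transpose_smul, Matrix.transpose_add, mul_smul_comm, smul_mul_assoc,
      mul_add, add_mul, hskew, hskew3]
    module
  · simp only [Matrix.transpose_smul, Matrix.transpose_sub, mul_smul_comm, smul_mul_assoc,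
      mul_sub, sub_mul, hskew, hskew3]
    module
end

section
/- Let Λ = [[s, qᵀ],[p, A]] be a G-orthogonal real 4×4 matrix with s > 1. Suppose α ∈ ℝ and a ∈ ℝ³ with ‖a‖ = 1 satisfy A·a = α·a. Then (a·q)² = α² − 1; in particular 1 ≤ α² ≤ s². Moreover, setting R := A − (1/(s+1))·p·qᵀ, the eigenvalue α satisfies the quadratic equation α² − (s+1)·⟨R a, a⟩·α + s = 0. -/
open Matrix

/-- The Minkowski matrix `G = diag(1,−1,−1,−1)` in `1+3` block form. -/
def G4 : Matrix (Fin 1 ⊕ Fin 3) (Fin 1 ⊕ Fin 3) ℝ :=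
  Matrix.fromBlocks 1 0 0 (-1)

/-- The 4×4 matrix `[[s, qᵀ],[p, A]]` assembled from its `1+3` blocks. -/
def assemble (s : ℝ) (p q : Fin 3 → ℝ) (A : Matrix (Fin 3) (Fin 3) ℝ) :
    Matrix (Fin 1 ⊕ Fin 3) (Fin 1 ⊕ Fin 3) ℝ :=
  Matrix.fromBlocks (Matrix.of fun _ _ => s) (Matrix.of fun _ j => q j)
    (Matrix.of fun i _ => p i) A

theorem G4_mul_self : G4 * G4 = 1 := by
  simp [G4, Matrix.fromBlocks_multiply]

theorem transpose_isLorentz {L : Matrix (Fin 1 ⊕ Fin 3) (Fin 1 ⊕ Fin 3) ℝ}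
    (hL : Lᵀ * G4 * L = G4) : L * G4 * Lᵀ = G4 := by
  have hleft : (G4 * Lᵀ * G4) * L = 1 := by
    rw [← G4_mul_self, Matrix.mul_assoc, Matrix.mul_assoc, ← Matrix.mul_assoc Lᵀ, hL]
  have hright : L * (G4 * Lᵀ * G4) = 1 := mul_eq_one_comm.mp hleft
  calc L * G4 * Lᵀ = L * (G4 * Lᵀ * G4) * G4 := by
        simp only [Matrix.mul_assoc, G4_mul_self, Matrix.mul_one]
    _ = G4 := by rw [hright, Matrix.one_mul]

section Blocks

variable {s : ℝ} {p q : Fin 3 → ℝ} {A : Matrix (Fin 3) (Fin 3) ℝ}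

theorem transpose_mul_self_of_isLorentz
    (hL : (assemble s p q A)ᵀ * G4 * assemble s p q A = G4) :
    Aᵀ * A = 1 + Matrix.vecMulVec q q := by
  ext i j
  have h := congrFun (congrFun hL (Sum.inr i)) (Sum.inr j)
  simp [assemble, G4, Matrix.fromBlocks_transpose, Matrix.fromBlocks_multiply,
    Matrix.mul_apply] at h
  simp [Matrix.mul_apply, Matrix.vecMulVec_apply]
  linarith

theorem vecMul_of_isLorentz
    (hL : (assemble s p q A)ᵀ * G4 * assemble s p q A = G4) :
    p ᵥ* A = s • q := by
  ext j
  have h := congrFun (congrFun hL (Sum.inl 0)) (Sum.inr j)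
  simp [assemble, G4, Matrix.fromBlocks_transpose, Matrix.fromBlocks_multiply,
    Matrix.mul_apply] at h
  simp [Matrix.vecMul, dotProduct]
  linarith

theorem dotProduct_self_of_isLorentz
    (hL : (assemble s p q A)ᵀ * G4 * assemble s p q A = G4) :
    q ⬝ᵥ q = s ^ 2 - 1 := by
  have h := congrFun (congrFun (transpose_isLorentz hL) (Sum.inl 0)) (Sum.inl 0)
  simp [assemble, G4, Matrix.fromBlocks_transpose, Matrix.fromBlocks_multiply,
    Matrix.mul_apply] at h
  simp only [dotProduct]
  linarith

end Blocks

/-- For a Lorentz matrix `[[s, qᵀ],[p, A]]` with `s > 1` and a real unit eigenvector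
`A·a = α·a`: `(a·q)² = α² − 1` (so `1 ≤ α² ≤ s²`) and, with
`R = A − p·qᵀ/(s+1)` (the rotation factor of the polar decomposition of `A`),
`α² − (s+1)·⟨Ra, a⟩·α + s = 0`. -/
theorem lorentz_spatial_eigenvalue (s : ℝ) (p q : Fin 3 → ℝ)
    (A : Matrix (Fin 3) (Fin 3) ℝ)
    (hL : (assemble s p q A)ᵀ * G4 * assemble s p q A = G4)
    (hs : 1 < s) (α : ℝ) (a : Fin 3 → ℝ) (ha : a ⬝ᵥ a = 1)
    (heig : A.mulVec a = α • a) :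
    (a ⬝ᵥ q) ^ 2 = α ^ 2 - 1 ∧ 1 ≤ α ^ 2 ∧ α ^ 2 ≤ s ^ 2 ∧
    ∀ R : Matrix (Fin 3) (Fin 3) ℝ,
      R = A - (s + 1)⁻¹ • Matrix.vecMulVec p q →
      α ^ 2 - (s + 1) * (R.mulVec a ⬝ᵥ a) * α + s = 0 := by
  have hsq : (a ⬝ᵥ q) ^ 2 = α ^ 2 - 1 := by
    have h : (A *ᵥ a) ⬝ᵥ (A *ᵥ a) = 1 + (a ⬝ᵥ q) ^ 2 := by
      rw [← Matrix.vecMul_transpose, ← Matrix.dotProduct_mulVec, vecMul_transpose,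
        Matrix.mulVec_mulVec, transpose_mul_self_of_isLorentz hL, Matrix.add_mulVec,
        Matrix.one_mulVec, dotProduct_add, ha, Matrix.vecMulVec_mulVec]
      simp [dotProduct_comm q a, sq]
    rw [heig] at h
    simp only [smul_dotProduct, dotProduct_smul, ha, smul_eq_mul] at h
    linarith
  have hcs : (a ⬝ᵥ q) ^ 2 ≤ s ^ 2 - 1 := by
    rw [← dotProduct_self_of_isLorentz hL, ← one_mul (q ⬝ᵥ q), ← ha]
    simpa only [dotProduct, sq] using Finset.sum_mul_sq_le_sq_mul_sq Finset.univ a q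
  refine ⟨hsq, by nlinarith [sq_nonneg (a ⬝ᵥ q)], by linarith, ?_⟩
  rintro R rfl
  have hp : s * (a ⬝ᵥ q) = α * (p ⬝ᵥ a) := by
    have h := Matrix.dotProduct_mulVec p A a
    rw [heig, vecMul_of_isLorentz hL, dotProduct_smul, smul_dotProduct,
      dotProduct_comm q a] at h
    exact h.symm
  have hR : (s + 1) * ((A - (s + 1)⁻¹ • Matrix.vecMulVec p q) *ᵥ a ⬝ᵥ a) =
      (s + 1) * α - (a ⬝ᵥ q) * (p ⬝ᵥ a) := by
    have hs' : s + 1 ≠ 0 := by linarith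
    rw [Matrix.sub_mulVec, heig, Matrix.smul_mulVec, Matrix.vecMulVec_mulVec]
    simp [sub_dotProduct, smul_dotProduct, ha, dotProduct_comm q a]
    field_simp
  rw [hR]
  linear_combination s * hsq - (a ⬝ᵥ q) * hp
end

section
/- Let Λ = [[s, qᵀ],[p, A]] be a G-orthogonal real 4×4 matrix with s ≥ 1, let t ∈ ℝ with t² = s² − 1 and v ∈ ℝ³ a unit vector with q = t·v, and define the symmetric 4×4 matrix P := [[s, t·vᵀ],[t·v, I + (s−1)·v·vᵀ]]. Then P² = ΛᵀΛ, and the eigen-system of P is: P·(1; v) = (s+t)·(1; v), P·(−1; v) = (s−t)·(−1; v), and P·(0; x) = (0; x) for every x ∈ ℝ³ with x·v = 0. In particular the eigenvalues of P are s+t, s−t (mutual reciprocals) and 1 (with multiplicity 2). -/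
open Matrix Polynomial

/-- The vector `(ε; x) ∈ ℝ⁴` with time component `ε` and space component `x`. -/
def timeSpace (ε : ℝ) (x : Fin 3 → ℝ) : Fin 1 ⊕ Fin 3 → ℝ :=
  Sum.elim (fun _ => ε) x

/-- Since `G + 1 = 2 e₀e₀ᵀ`, the Gram matrix of a Lorentz matrix with first row `(s; q)` is
`2 (s; q)(s; q)ᵀ - G`. -/
theorem transpose_mul_self_of_lorentz {s : ℝ} {p q : Fin 3 → ℝ} {A : Matrix (Fin 3) (Fin 3) ℝ}
    (hL : (assemble s p q A)ᵀ * G4 * assemble s p q A = G4) :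
    (assemble s p q A)ᵀ * assemble s p q A =
      (2 : ℝ) • vecMulVec (timeSpace s q) (timeSpace s q) - G4 := by
  rw [eq_sub_iff_add_eq]
  nth_rw 1 [← hL]
  ext i j
  rcases i with i | i <;> rcases j with j | j <;>
    simp [assemble, G4, timeSpace, Matrix.mul_apply, vecMulVec_apply, Fin.sum_univ_three,
      Matrix.one_apply] <;> ring

theorem assemble_boost_mul_self {s t : ℝ} {v : Fin 3 → ℝ} (ht : t ^ 2 = s ^ 2 - 1)
    (hv : v ⬝ᵥ v = 1) :
    assemble s (t • v) (t • v) (1 + (s - 1) • vecMulVec v v) *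
        assemble s (t • v) (t • v) (1 + (s - 1) • vecMulVec v v) =
      (2 : ℝ) • vecMulVec (timeSpace s (t • v)) (timeSpace s (t • v)) - G4 := by
  have hblock : (1 + (s - 1) • vecMulVec v v) * (1 + (s - 1) • vecMulVec v v) =
      1 + (s ^ 2 - 1) • vecMulVec v v := by
    have hvv : vecMulVec v v * vecMulVec v v = vecMulVec v v := by
      rw [vecMulVec_mul_vecMulVec, hv, one_smul]
    simp only [mul_add, add_mul, one_mul, mul_one, smul_mul_assoc, mul_smul_comm, hvv]
    module
  have hblock' (i j : Fin 3) := congrFun (congrFun hblock i) j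
  simp only [Matrix.mul_apply, Fin.sum_univ_three] at hblock'
  rw [dotProduct, Fin.sum_univ_three] at hv
  ext i j
  rcases i with i | i <;> rcases j with j | j
  · obtain rfl := Subsingleton.elim i j
    simp [assemble, G4, timeSpace, Matrix.mul_apply, vecMulVec_apply, Fin.sum_univ_three]
    linear_combination t ^ 2 * hv + ht
  · fin_cases j <;>
    simp [assemble, G4, timeSpace, Matrix.mul_apply, vecMulVec_apply, Fin.sum_univ_three,
      Matrix.one_apply]
    · linear_combination t * (s - 1) * v 0 * hv
    · linear_combination t * (s - 1) * v 1 * hv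
    · linear_combination t * (s - 1) * v 2 * hv
  · fin_cases i <;>
    simp [assemble, G4, timeSpace, Matrix.mul_apply, vecMulVec_apply, Fin.sum_univ_three,
      Matrix.one_apply]
    · linear_combination t * (s - 1) * v 0 * hv
    · linear_combination t * (s - 1) * v 1 * hv
    · linear_combination t * (s - 1) * v 2 * hv
  · have h := hblock' i j
    simp [assemble, G4, timeSpace, Matrix.mul_apply, vecMulVec_apply, Fin.sum_univ_three] at h ⊢
    linear_combination h - v i * v j * ht

theorem assemble_mulVec_timeSpace (s ε : ℝ) (p q x : Fin 3 → ℝ) (A : Matrix (Fin 3) (Fin 3) ℝ) :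
    (assemble s p q A) *ᵥ timeSpace ε x = timeSpace (s * ε + q ⬝ᵥ x) (ε • p + A *ᵥ x) := by
  ext i
  rcases i with i | i
  · simp [assemble, timeSpace, mulVec, dotProduct, Fin.sum_univ_three]
  · simp [assemble, timeSpace, mulVec, dotProduct, Fin.sum_univ_three]
    ring

theorem smul_timeSpace (c ε : ℝ) (x : Fin 3 → ℝ) :
    c • timeSpace ε x = timeSpace (c * ε) (c • x) := by
  ext i
  rcases i with i | i <;> simp [timeSpace]

theorem boost_mulVec_timeSpace (s t ε : ℝ) (v x : Fin 3 → ℝ) :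
    (assemble s (t • v) (t • v) (1 + (s - 1) • vecMulVec v v)) *ᵥ timeSpace ε x =
      timeSpace (s * ε + t * (v ⬝ᵥ x)) ((t * ε + (s - 1) * (v ⬝ᵥ x)) • v + x) := by
  rw [assemble_mulVec_timeSpace, add_mulVec, smul_mulVec, vecMulVec_mulVec, one_mulVec,
    smul_dotProduct, smul_eq_mul]
  congr 1
  ext i
  simp
  ring

theorem charpoly_boost {s t : ℝ} {v : Fin 3 → ℝ} (hv : v ⬝ᵥ v = 1) :
    (assemble s (t • v) (t • v) (1 + (s - 1) • vecMulVec v v)).charpoly =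
      (X - C (s + t)) * (X - C (s - t)) * (X - C 1) ^ 2 := by
  have hC : C (v 0) * C (v 0) + C (v 1) * C (v 1) + C (v 2) * C (v 2) = (1 : ℝ[X]) := by
    rw [dotProduct, Fin.sum_univ_three] at hv
    simp only [← C_mul, ← C_add, hv, C_1]
  rw [← charpoly_reindex finSumFinEquiv, charpoly,
    show charmatrix _ = !![X - C s, -(C t * C (v 0)), -(C t * C (v 1)), -(C t * C (v 2));
      -(C t * C (v 0)), X - 1 - (C s - 1) * (C (v 0) * C (v 0)),
        -((C s - 1) * (C (v 0) * C (v 1))), -((C s - 1) * (C (v 0) * C (v 2)));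
      -(C t * C (v 1)), -((C s - 1) * (C (v 1) * C (v 0))),
        X - 1 - (C s - 1) * (C (v 1) * C (v 1)), -((C s - 1) * (C (v 1) * C (v 2)));
      -(C t * C (v 2)), -((C s - 1) * (C (v 2) * C (v 0))),
        -((C s - 1) * (C (v 2) * C (v 1))), X - 1 - (C s - 1) * (C (v 2) * C (v 2))] from ?_]
  · simp [det_succ_row_zero, Fin.sum_univ_succ, Fin.succAbove, submatrix]
    linear_combination (-(X - 1) ^ 2 * ((X - C s) * (C s - 1) + C t ^ 2)) * hC
  · have e0 : (finSumFinEquiv.symm 0 : Fin 1 ⊕ Fin 3) = Sum.inl 0 := rfl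
    have e1 : (finSumFinEquiv.symm 1 : Fin 1 ⊕ Fin 3) = Sum.inr 0 := rfl
    have e2 : (finSumFinEquiv.symm 2 : Fin 1 ⊕ Fin 3) = Sum.inr 1 := rfl
    have e3 : (finSumFinEquiv.symm 3 : Fin 1 ⊕ Fin 3) = Sum.inr 2 := rfl
    ext1 i j
    fin_cases i <;> fin_cases j <;>
      simp [e0, e1, e2, e3, assemble, vecMulVec_apply, sub_sub]

/-- Eigen-system of the positive part `P = [[s, t·vᵀ],[t·v, I + (s−1)·vvᵀ]]` of a
Lorentz matrix `Λ`: `P² = ΛᵀΛ`, `P(1;v) = (s+t)(1;v)`, `P(−1;v) = (s−t)(−1;v)`,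
`P(0;x) = (0;x)` for `x ⊥ v`; the eigenvalues are `s+t`, `s−t` (mutual reciprocals)
and `1` with multiplicity two. -/
theorem lorentz_positive_part_eigen (s t : ℝ) (p q v : Fin 3 → ℝ)
    (A : Matrix (Fin 3) (Fin 3) ℝ)
    (hL : (assemble s p q A)ᵀ * G4 * assemble s p q A = G4)
    (hs : 1 ≤ s) (ht : t ^ 2 = s ^ 2 - 1) (hv : v ⬝ᵥ v = 1) (hq : q = t • v) :
    ∀ P : Matrix (Fin 1 ⊕ Fin 3) (Fin 1 ⊕ Fin 3) ℝ,
      P = assemble s (t • v) (t • v) (1 + (s - 1) • Matrix.vecMulVec v v) →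
      P * P = (assemble s p q A)ᵀ * assemble s p q A ∧
      P.mulVec (timeSpace 1 v) = (s + t) • timeSpace 1 v ∧
      P.mulVec (timeSpace (-1) v) = (s - t) • timeSpace (-1) v ∧
      (∀ x : Fin 3 → ℝ, x ⬝ᵥ v = 0 →
        P.mulVec (timeSpace 0 x) = timeSpace 0 x) ∧
      (s + t) * (s - t) = 1 ∧
      P.charpoly = (X - C (s + t)) * (X - C (s - t)) * (X - C 1) ^ 2 := by
  rintro P rfl
  refine ⟨?_, ?_, ?_, fun x hx => ?_, by linear_combination -ht, charpoly_boost hv⟩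
  · rw [transpose_mul_self_of_lorentz hL, assemble_boost_mul_self ht hv, hq]
  · rw [boost_mulVec_timeSpace, smul_timeSpace, hv]
    congr 1
    · ring
    · module
  · rw [boost_mulVec_timeSpace, smul_timeSpace, hv]
    congr 1
    · ring
    · module
  · rw [boost_mulVec_timeSpace, dotProduct_comm, hx]
    simp
end

section
/- Let d ≥ 2 and p = d². Suppose σ₀, σ₁, …, σ_{p−1} are d×d complex matrices such that: σ₀ = I; every σ_k is Hermitian with σ_k² = I; σ_j·σ_k = −σ_k·σ_j for all distinct j, k with 1 ≤ j, k ≤ p−1; and (1/d)·tr(σ_j·σ_k) = δ_{jk} for all 0 ≤ j, k ≤ p−1 (so the σ_k form an orthonormal basis of the d²-dimensional space of d×d complex matrices with respect to the normalized trace inner product). Then d = 2 (equivalently p = 4). -/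
open Matrix

namespace Matrix

variable {n ι : Type*} [Fintype n] [Fintype ι] [DecidableEq ι]

/-- A family of `|n|²` matrices that is orthogonal for the trace form, up to a nonzero scalar,
detects whether a matrix vanishes. -/
theorem eq_zero_of_trace_mul_eq_zero_of_orthogonal {K : Type*} [Field K]
    (hcard : Fintype.card ι = Fintype.card n * Fintype.card n) {τ σ : ι → Matrix n n K} {c : K}
    (hc : c ≠ 0) (horth : ∀ j k, (τ j * σ k).trace = if j = k then c else 0) {B : Matrix n n K}
    (hB : ∀ k, (τ k * B).trace = 0) : B = 0 := by
  have hli : LinearIndependent K σ := by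
    rw [Fintype.linearIndependent_iff]
    intro g hg j
    have h : (τ j * ∑ k, g k • σ k).trace = 0 := by rw [hg, mul_zero, trace_zero]
    simpa [Finset.mul_sum, trace_sum, horth, hc] using h
  have hspan : B ∈ Submodule.span K (Set.range σ) := by
    rw [hli.span_eq_top_of_card_eq_finrank' (by simp [hcard, Module.finrank_matrix])]
    trivial
  obtain ⟨g, rfl⟩ := (Submodule.mem_span_range_iff_exists_fun K).1 hspan
  have hg : ∀ j, g j = 0 := fun j ↦ by
    simpa [Finset.mul_sum, trace_sum, horth, hc] using hB j
  simp [hg]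

/-- The trace of `A * B` vanishes if some involution commutes with `B` and anticommutes with
`A`. -/
theorem trace_mul_eq_zero_of_anticommute_of_commute [DecidableEq n] {K : Type*}
    [Field K] [CharZero K]
    {A B U : Matrix n n K} (hU : U * U = 1) (hA : U * A = -(A * U)) (hB : Commute U B) :
    (A * B).trace = 0 := by
  have h : (A * B).trace = -(A * B).trace := by
    calc (A * B).trace = (U * (U * (A * B))).trace := by rw [← mul_assoc, hU, one_mul]
      _ = (U * (A * B) * U).trace := trace_mul_comm _ _
      _ = (-(A * (U * B * U))).trace := by
        rw [← mul_assoc, hA, neg_mul, neg_mul]; simp only [mul_assoc]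
      _ = -(A * B).trace := by rw [hB.eq, mul_assoc, hU, mul_one, trace_neg]
  exact self_eq_neg.1 h

end Matrix

/-- A Pauli-like basis (identity, Hermitian square roots of the identity, pairwise
anticommuting, orthonormal for the normalized trace inner product) of the space of
`d×d` complex matrices exists only for `d = 2`. -/
theorem pauli_basis_only_dim_two (d : ℕ) (hd : 2 ≤ d)
    (σ : Fin (d * d) → Matrix (Fin d) (Fin d) ℂ)
    (h0 : ∀ j : Fin (d * d), (j : ℕ) = 0 → σ j = 1)
    (hherm : ∀ k, (σ k)ᴴ = σ k)
    (hsq : ∀ k, σ k ^ 2 = 1)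
    (hanti : ∀ j k : Fin (d * d), (j : ℕ) ≠ 0 → (k : ℕ) ≠ 0 → j ≠ k →
      σ j * σ k = -(σ k * σ j))
    (horth : ∀ j k : Fin (d * d),
      ((d : ℂ))⁻¹ * ((σ j)ᴴ * σ k).trace = if j = k then 1 else 0) :
    d = 2 := by
  by_contra hd2
  have hd3 : 9 ≤ d * d := Nat.mul_le_mul (show 3 ≤ d by omega) (show 3 ≤ d by omega)
  have hdC : (d : ℂ) ≠ 0 := Nat.cast_ne_zero.2 (by omega)
  have hsq' : ∀ k, σ k * σ k = 1 := fun k ↦ by rw [← sq, hsq]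
  have htr : ∀ j k, (σ j * σ k).trace = if j = k then (d : ℂ) else 0 := by
    intro j k
    have h := horth j k
    rw [hherm, inv_mul_eq_iff_eq_mul₀ hdC] at h
    simpa using h
  have htr_zero : ∀ k : Fin (d * d), (k : ℕ) ≠ 0 → (σ k).trace = 0 := by
    intro k hk
    have h := htr ⟨0, by omega⟩ k
    rwa [h0 _ rfl, one_mul, if_neg fun h ↦ hk (congrArg Fin.val h).symm] at h
  obtain ⟨a, ha⟩ : ∃ a : Fin (d * d), (a : ℕ) = 1 := ⟨⟨1, by omega⟩, rfl⟩
  obtain ⟨b, hb⟩ : ∃ b : Fin (d * d), (b : ℕ) = 2 := ⟨⟨2, by omega⟩, rfl⟩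
  have hab : a ≠ b := fun h ↦ by simp [h, hb] at ha
  have hprod : σ a * σ b = 0 := by
    refine eq_zero_of_trace_mul_eq_zero_of_orthogonal (by simp) hdC htr fun k ↦ ?_
    by_cases hk0 : (k : ℕ) = 0
    · rw [h0 k hk0, one_mul, htr, if_neg hab]
    by_cases hka : k = a
    · rw [hka, ← mul_assoc, hsq', one_mul, htr_zero b (by omega)]
    by_cases hkb : k = b
    · rw [hkb, trace_mul_comm, mul_assoc, hsq', mul_one, htr_zero a (by omega)]
    obtain ⟨m, hm, hmk⟩ : ∃ m : Fin (d * d), 3 ≤ (m : ℕ) ∧ m ≠ k := by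
      by_cases h : (k : ℕ) = 3
      · exact ⟨⟨4, by omega⟩, by simp, fun e ↦ by simp [← e] at h⟩
      · exact ⟨⟨3, by omega⟩, by simp, fun e ↦ by simp [← e] at h⟩
    refine trace_mul_eq_zero_of_anticommute_of_commute (hsq' m)
      (hanti m k (by omega) hk0 hmk) ?_
    have hma := hanti m a (by omega) (by omega) fun h ↦ by omega
    have hmb := hanti m b (by omega) (by omega) fun h ↦ by omega
    rw [commute_iff_eq, ← mul_assoc, hma, neg_mul, mul_assoc, hmb, mul_neg, neg_neg, mul_assoc]
  have hσb : σ b = 0 := by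
    rw [← one_mul (σ b), ← hsq' a, mul_assoc, hprod, mul_zero]
  have h := htr b b
  rw [hσb, zero_mul, trace_zero, if_pos rfl] at h
  exact hdC h.symm
end

section
/- Let Λ be a proper Lorentz matrix (Λᵀ G Λ = G, det Λ = 1, Λ₀₀ > 0). Then there exists a 2×2 complex matrix M with det M = 1 such that σ(Λx) = M·σ(x)·M* for every x ∈ ℝ⁴. Moreover M is unique up to sign: if M' is a 2×2 complex matrix with det M' = 1 satisfying σ(Λx) = M'·σ(x)·M'* for all x ∈ ℝ⁴, then M' = M or M' = −M. -/
open Matrix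

/-- Pauli coding of `x ∈ ℝ⁴`: `σ(x) = x₀σ₀ + x₁σ₁ + x₂σ₂ + x₃σ₃`, a Hermitian
`2×2` complex matrix. -/
noncomputable def pauli (x : Fin 4 → ℝ) : Matrix (Fin 2) (Fin 2) ℂ :=
  !![(x 0 : ℂ) + (x 3 : ℂ), (x 1 : ℂ) - (x 2 : ℂ) * Complex.I;
     (x 1 : ℂ) + (x 2 : ℂ) * Complex.I, (x 0 : ℂ) - (x 3 : ℂ)]

/-- The Pauli matrices `σ₀, σ₁, σ₂, σ₃`. -/
noncomputable def pauliBasis (i : Fin 4) : Matrix (Fin 2) (Fin 2) ℂ := pauli (Pi.single i 1)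

lemma pauliBasis_zero : pauliBasis 0 = 1 := by
  ext i j; fin_cases i <;> fin_cases j <;> simp [pauliBasis, pauli]

lemma pauliBasis_one : pauliBasis 1 = !![0, 1; 1, 0] := by
  ext i j; fin_cases i <;> fin_cases j <;> simp [pauliBasis, pauli]

lemma pauliBasis_two : pauliBasis 2 = !![0, -Complex.I; Complex.I, 0] := by
  ext i j; fin_cases i <;> fin_cases j <;> simp [pauliBasis, pauli]

lemma pauliBasis_three : pauliBasis 3 = !![1, 0; 0, -1] := by
  ext i j; fin_cases i <;> fin_cases j <;> simp [pauliBasis, pauli]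

lemma pauli_eq_sum (x : Fin 4 → ℝ) : pauli x = ∑ i, (x i : ℂ) • pauliBasis i := by
  rw [Fin.sum_univ_four, pauliBasis_zero, pauliBasis_one, pauliBasis_two, pauliBasis_three]
  ext i j; fin_cases i <;> fin_cases j <;> simp [pauli] <;> ring

lemma pauli_mulVec (Λ : Matrix (Fin 4) (Fin 4) ℝ) (x : Fin 4 → ℝ) :
    pauli (Λ *ᵥ x) = ∑ i, (x i : ℂ) • pauli (Λ.col i) := by
  ext i j; fin_cases i <;> fin_cases j <;>
    simp [pauli, mulVec, dotProduct, Fin.sum_univ_four] <;> ring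

lemma conjTranspose_pauli (x : Fin 4 → ℝ) : (pauli x)ᴴ = pauli x := by
  ext i j; fin_cases i <;> fin_cases j <;> simp [pauli, sub_eq_add_neg]

/-- The Clifford relation for the Pauli coding. -/
lemma pauli_mul_adjugate_add (x y : Fin 4 → ℝ) :
    pauli x * (pauli y).adjugate + pauli y * (pauli x).adjugate
      = ((2 * (x ⬝ᵥ Gmat *ᵥ y) : ℝ) : ℂ) • 1 := by
  have hI := Complex.I_mul_I
  ext i j; fin_cases i <;> fin_cases j <;>
    simp [pauli, Gmat, adjugate_fin_two, dotProduct, mulVec_diagonal, Fin.sum_univ_four] <;>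
    first | ring1 | linear_combination (2 * (x 2 : ℂ) * y 2) * hI

lemma det_pauli (x : Fin 4 → ℝ) : (pauli x).det = ((x ⬝ᵥ Gmat *ᵥ x : ℝ) : ℂ) := by
  simp [pauli, Gmat, det_fin_two, dotProduct, mulVec_diagonal, Fin.sum_univ_four]
  linear_combination (x 2 : ℂ) ^ 2 * Complex.I_mul_I

lemma trace_pauli (x : Fin 4 → ℝ) : (pauli x).trace = 2 * (x 0 : ℂ) := by
  simp [pauli, trace_fin_two]; ring

/-- The trace of an alternating product of four Pauli codings. -/
lemma trace_pauli_mul_four (Λ : Matrix (Fin 4) (Fin 4) ℝ) :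
    (pauli (Λ.col 1) * (pauli (Λ.col 2)).adjugate * pauli (Λ.col 3)
      * (pauli (Λ.col 0)).adjugate).trace =
    2 * ((Λ.col 1 ⬝ᵥ Gmat *ᵥ Λ.col 2 : ℝ) * (Λ.col 3 ⬝ᵥ Gmat *ᵥ Λ.col 0 : ℝ)
      - (Λ.col 1 ⬝ᵥ Gmat *ᵥ Λ.col 3 : ℝ) * (Λ.col 2 ⬝ᵥ Gmat *ᵥ Λ.col 0 : ℝ)
      + (Λ.col 1 ⬝ᵥ Gmat *ᵥ Λ.col 0 : ℝ) * (Λ.col 2 ⬝ᵥ Gmat *ᵥ Λ.col 3 : ℝ)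
      - Complex.I * (Λ.det : ℝ)) := by
  have hI := Complex.I_sq
  simp [pauli, Gmat, adjugate_fin_two, dotProduct, mulVec_diagonal,
    trace_fin_two, det_succ_row_zero, Fin.sum_univ_succ, Fin.succAbove]
  ring_nf
  simp only [hI, Complex.I_pow_four]
  ring

lemma dotProduct_col_of_lorentz {Λ : Matrix (Fin 4) (Fin 4) ℝ} (hL : Λᵀ * Gmat * Λ = Gmat)
    (i j : Fin 4) : Λ.col i ⬝ᵥ Gmat *ᵥ Λ.col j = Gmat i j := by
  conv_rhs => rw [← hL, Matrix.mul_assoc]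
  rfl

lemma eq_smul_one_of_commute {X : Matrix (Fin 2) (Fin 2) ℂ}
    (h1 : X * pauliBasis 1 = pauliBasis 1 * X) (h3 : X * pauliBasis 3 = pauliBasis 3 * X) :
    X = X 0 0 • 1 := by
  rw [pauliBasis_one] at h1
  rw [pauliBasis_three] at h3
  have a := congrFun₂ h1 0 1
  have b := congrFun₂ h3 0 1
  have c := congrFun₂ h3 1 0
  simp [Matrix.mul_apply, neg_eq_iff_add_eq_zero, eq_neg_iff_add_eq_zero] at a b c
  ext i j; fin_cases i <;> fin_cases j <;> simp <;> grind

lemma eq_smul_pauliBasis_two {X : Matrix (Fin 2) (Fin 2) ℂ}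
    (h1 : X * pauliBasis 1 = -(pauliBasis 1 * X))
    (h3 : X * pauliBasis 3 = -(pauliBasis 3 * X)) :
    X = (Complex.I * X 0 1) • pauliBasis 2 := by
  rw [pauliBasis_one] at h1
  rw [pauliBasis_three] at h3
  have a := congrFun₂ h1 0 0
  have b := congrFun₂ h3 0 0
  have c := congrFun₂ h3 1 1
  have hI := Complex.I_sq
  rw [pauliBasis_two]
  simp [Matrix.mul_apply, vecMul, dotProduct] at a b c
  ext i j; fin_cases i <;> fin_cases j <;> simp <;> grind

/-- Two anticommuting involutions of `ℂ²` are simultaneously conjugate to `σ₁` and `σ₃`. -/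
lemma exists_intertwiner_of_anticommute {C₁ C₃ : Matrix (Fin 2) (Fin 2) ℂ} (h11 : C₁ * C₁ = 1)
    (h33 : C₃ * C₃ = 1) (h13 : C₁ * C₃ = -(C₃ * C₁)) :
    ∃ M : Matrix (Fin 2) (Fin 2) ℂ, M.det = 1 ∧
      C₁ * M = M * pauliBasis 1 ∧ C₃ * M = M * pauliBasis 3 := by
  obtain ⟨u, hu, hCu⟩ : ∃ u ≠ 0, (C₃ - 1) *ᵥ u = 0 := by
    rw [exists_mulVec_eq_zero_iff]
    by_contra hd
    have hU : IsUnit (C₃ - 1) := (isUnit_iff_isUnit_det _).2 (isUnit_iff_ne_zero.2 hd)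
    have h0 : (C₃ - 1) * (C₃ + 1) = 0 := by noncomm_ring; simp [h33]
    have h3 : C₃ = -1 := eq_neg_of_add_eq_zero_left ((hU.mul_right_eq_zero).1 h0)
    have hC : C₁ = 0 := by
      rw [h3] at h13
      ext i j
      have := congrFun₂ h13 i j
      simp at this
      simpa using (neg_eq_self (a := C₁ i j)).1 this
    simp [hC] at h11
  have h3u : C₃ *ᵥ u = u := by
    rw [sub_mulVec, one_mulVec, sub_eq_zero] at hCu; exact hCu
  have h1v : C₁ *ᵥ (C₁ *ᵥ u) = u := by rw [mulVec_mulVec, h11, one_mulVec]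
  have h3v : C₃ *ᵥ (C₁ *ᵥ u) = -(C₁ *ᵥ u) := by
    rw [mulVec_mulVec, ← neg_neg (C₃ * C₁), ← h13, neg_mulVec, ← mulVec_mulVec, h3u]
  generalize hv : C₁ *ᵥ u = v at *
  let K : Matrix (Fin 2) (Fin 2) ℂ := of fun i j => ![u i, v i] j
  have hK1 : C₁ * K = K * pauliBasis 1 := by
    rw [pauliBasis_one]
    ext i j
    have a := congrFun hv i
    have b := congrFun h1v i
    simp only [mulVec, dotProduct, Fin.sum_univ_two] at a b
    fin_cases j <;> simpa [K, Matrix.mul_apply]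
  have hK3 : C₃ * K = K * pauliBasis 3 := by
    rw [pauliBasis_three]
    ext i j
    have a := congrFun h3u i
    have b := congrFun h3v i
    simp only [mulVec, dotProduct, Fin.sum_univ_two] at a b
    fin_cases j <;> simpa [K, Matrix.mul_apply]
  have hKd : K.det ≠ 0 := by
    intro hd
    obtain ⟨w, hw, hKw⟩ := exists_mulVec_eq_zero_iff.2 hd
    have e : w 0 • u + w 1 • v = 0 := by
      ext i
      simpa [K, mulVec, dotProduct, mul_comm] using congrFun hKw i
    have e' : w 0 • u - w 1 • v = 0 := by
      simpa [mulVec_add, mulVec_smul, h3u, h3v, ← sub_eq_add_neg] using congrArg (C₃ *ᵥ ·) e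
    have hv0 : v ≠ 0 := by rintro rfl; exact hu (by simpa using h1v.symm)
    have e0 : (2 : ℂ) • w 0 • u = 0 := by rw [two_smul]; linear_combination e + e'
    have e1 : (2 : ℂ) • w 1 • v = 0 := by rw [two_smul]; linear_combination e - e'
    apply hw
    ext i; fin_cases i
    · simpa [hu] using e0
    · simpa [hv0] using e1
  obtain ⟨z, hz⟩ := IsAlgClosed.exists_eq_mul_self K.det⁻¹
  refine ⟨z • K, ?_, ?_, ?_⟩
  · rw [det_smul, Fintype.card_fin, sq, ← hz, inv_mul_cancel₀ hKd]
  · rw [Matrix.mul_smul, hK1, Matrix.smul_mul]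
  · rw [Matrix.mul_smul, hK3, Matrix.smul_mul]

lemma exists_pauli_intertwiner {C₁ C₂ C₃ : Matrix (Fin 2) (Fin 2) ℂ} (h11 : C₁ * C₁ = 1)
    (h33 : C₃ * C₃ = 1) (h13 : C₁ * C₃ = -(C₃ * C₁)) (h21 : C₂ * C₁ = -(C₁ * C₂))
    (h23 : C₂ * C₃ = -(C₃ * C₂)) (htr : (C₁ * C₂ * C₃).trace = 2 * Complex.I) :
    ∃ M : Matrix (Fin 2) (Fin 2) ℂ, M.det = 1 ∧
      C₁ * M = M * pauliBasis 1 ∧ C₂ * M = M * pauliBasis 2 ∧ C₃ * M = M * pauliBasis 3 := by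
  obtain ⟨M, hM, h1, h3⟩ := exists_intertwiner_of_anticommute h11 h33 h13
  refine ⟨M, hM, h1, ?_, h3⟩
  have hu : IsUnit M.det := by simp [hM]
  have hr := mul_nonsing_inv M hu
  have hl := nonsing_inv_mul M hu
  obtain ⟨D, hD⟩ : ∃ D, C₂ * M = M * D := ⟨M⁻¹ * (C₂ * M), by rw [← mul_assoc, hr, one_mul]⟩
  have cancel : ∀ {X Y : Matrix (Fin 2) (Fin 2) ℂ}, M * X = M * Y → X = Y := fun {X Y} h => by
    simpa [← mul_assoc, hl] using congrArg (M⁻¹ * ·) h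
  have e1 : D * pauliBasis 1 = -(pauliBasis 1 * D) := cancel <| by
    rw [← mul_assoc, ← hD, mul_assoc, ← h1, ← mul_assoc, h21, mul_neg, ← mul_assoc, ← h1,
      mul_assoc C₁, ← hD, neg_mul, mul_assoc]
  have e3 : D * pauliBasis 3 = -(pauliBasis 3 * D) := cancel <| by
    rw [← mul_assoc, ← hD, mul_assoc, ← h3, ← mul_assoc, h23, mul_neg, ← mul_assoc, ← h3,
      mul_assoc C₃, ← hD, neg_mul, mul_assoc]
  have hP : C₁ * C₂ * C₃ * M = M * (pauliBasis 1 * D * pauliBasis 3) := by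
    rw [mul_assoc, h3, ← mul_assoc, mul_assoc C₁, hD, ← mul_assoc C₁, h1]
    simp only [mul_assoc]
  have ht : (pauliBasis 1 * D * pauliBasis 3).trace = 2 * Complex.I := by
    rw [← htr, ← one_mul (pauliBasis 1 * D * pauliBasis 3), ← hl, mul_assoc, ← hP,
      trace_mul_comm, mul_assoc, hr, mul_one]
  have hD2 := eq_smul_pauliBasis_two e1 e3
  generalize Complex.I * D 0 1 = c at hD2
  have hc : c = 1 := by
    rw [hD2, pauliBasis_one, pauliBasis_two, pauliBasis_three] at ht
    simp [trace_fin_two] at ht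
    have : (2 * Complex.I) * (c - 1) = 0 := by linear_combination ht
    simpa [sub_eq_zero] using this
  rw [hD, hD2, hc, one_smul]

lemma pauli_col_mul_adjugate {Λ : Matrix (Fin 4) (Fin 4) ℝ} (hL : Λᵀ * Gmat * Λ = Gmat)
    {i j : Fin 4} (hij : i ≠ j) :
    pauli (Λ.col i) * (pauli (Λ.col j)).adjugate
      = -(pauli (Λ.col j) * (pauli (Λ.col i)).adjugate) := by
  rw [← add_eq_zero_iff_eq_neg, pauli_mul_adjugate_add, dotProduct_col_of_lorentz hL]
  simp [Gmat, hij]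

lemma det_pauli_col_zero {Λ : Matrix (Fin 4) (Fin 4) ℝ} (hL : Λᵀ * Gmat * Λ = Gmat) :
    (pauli (Λ.col 0)).det = 1 := by
  rw [det_pauli, dotProduct_col_of_lorentz hL]; simp [Gmat]

lemma det_pauli_col {Λ : Matrix (Fin 4) (Fin 4) ℝ} (hL : Λᵀ * Gmat * Λ = Gmat)
    {i : Fin 4} (hi : i ≠ 0) : (pauli (Λ.col i)).det = -1 := by
  rw [det_pauli, dotProduct_col_of_lorentz hL]
  fin_cases i <;> simp [Gmat] at hi ⊢

lemma pauli_col_mul_pauli_col {Λ : Matrix (Fin 4) (Fin 4) ℝ} (hL : Λᵀ * Gmat * Λ = Gmat)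
    (i : Fin 4) {j : Fin 4} (hj : j ≠ 0) :
    (pauli (Λ.col i) * (pauli (Λ.col 0)).adjugate)
        * (pauli (Λ.col j) * (pauli (Λ.col 0)).adjugate)
      = -(pauli (Λ.col i) * (pauli (Λ.col j)).adjugate) := by
  have h0 : (pauli (Λ.col 0)).adjugate * pauli (Λ.col 0) = 1 := by
    rw [adjugate_mul, det_pauli_col_zero hL, one_smul]
  rw [pauli_col_mul_adjugate hL hj, mul_neg, ← mul_assoc, mul_assoc (pauli (Λ.col i)), h0,
    mul_one]

/-- A future-pointing multiple of `M Mᴴ` of determinant one equals `M Mᴴ`. -/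
lemma eq_one_of_smul_mul_conjTranspose {M : Matrix (Fin 2) (Fin 2) ℂ} (hM : M.det = 1) {h : ℂ}
    {x : Fin 4 → ℝ} (hx : 0 < x 0) (hdx : (pauli x).det = 1) (hh : pauli x = h • (M * Mᴴ)) :
    h = 1 := by
  have hsq : h ^ 2 = 1 := by
    have := congrArg det hh
    simpa [hdx, hM, det_smul, eq_comm] using this
  rcases eq_or_eq_neg_of_sq_eq_sq _ _ (hsq.trans (one_pow 2).symm) with h1 | h1
  · exact h1
  · exfalso
    have ht := congrArg (fun X => (trace X).re) hh
    rw [trace_pauli, h1] at ht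
    simp [trace_fin_two, Matrix.mul_apply] at ht
    nlinarith [mul_self_nonneg (M 0 0).re, mul_self_nonneg (M 0 0).im,
      mul_self_nonneg (M 0 1).re, mul_self_nonneg (M 0 1).im, mul_self_nonneg (M 1 0).re,
      mul_self_nonneg (M 1 0).im, mul_self_nonneg (M 1 1).re, mul_self_nonneg (M 1 1).im]

lemma eq_of_conj_eq {M X Y : Matrix (Fin 2) (Fin 2) ℂ} (hM : M.det = 1)
    (h : M * X * Mᴴ = M * Y * Mᴴ) : X = Y := by
  have hr := mul_nonsing_inv M (by simp [hM])
  have hl := nonsing_inv_mul M (by simp [hM])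
  have e := congrArg (M⁻¹ * · * (M⁻¹)ᴴ) h
  simpa [← mul_assoc, hl, mul_assoc _ Mᴴ, ← conjTranspose_mul] using e

/-- Existence of the spinor representative of a proper Lorentz matrix. -/
lemma exists_conj_of_lorentz {Λ : Matrix (Fin 4) (Fin 4) ℝ} (hL : Λᵀ * Gmat * Λ = Gmat)
    (hdet : Λ.det = 1) (h00 : 0 < Λ 0 0) :
    ∃ M : Matrix (Fin 2) (Fin 2) ℂ, M.det = 1 ∧
      ∀ i, pauli (Λ.col i) = M * pauliBasis i * Mᴴ := by
  have h0 : (pauli (Λ.col 0)).adjugate * pauli (Λ.col 0) = 1 := by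
    rw [adjugate_mul, det_pauli_col_zero hL, one_smul]
  have hsq : ∀ i ≠ 0, (pauli (Λ.col i) * (pauli (Λ.col 0)).adjugate)
      * (pauli (Λ.col i) * (pauli (Λ.col 0)).adjugate) = 1 := fun i hi => by
    rw [pauli_col_mul_pauli_col hL i hi, mul_adjugate, det_pauli_col hL hi, neg_smul, one_smul,
      neg_neg]
  have hanti : ∀ i ≠ 0, ∀ j ≠ 0, i ≠ j → (pauli (Λ.col i) * (pauli (Λ.col 0)).adjugate)
      * (pauli (Λ.col j) * (pauli (Λ.col 0)).adjugate)
      = -((pauli (Λ.col j) * (pauli (Λ.col 0)).adjugate)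
      * (pauli (Λ.col i) * (pauli (Λ.col 0)).adjugate)) := fun i hi j hj hij => by
    rw [pauli_col_mul_pauli_col hL i hj, pauli_col_mul_pauli_col hL j hi,
      pauli_col_mul_adjugate hL hij]
  obtain ⟨M, hM, h1, h2, h3⟩ := exists_pauli_intertwiner (hsq 1 (by decide)) (hsq 3 (by decide))
    (hanti 1 (by decide) 3 (by decide) (by decide)) (hanti 2 (by decide) 1 (by decide) (by decide))
    (hanti 2 (by decide) 3 (by decide) (by decide)) (by
      rw [pauli_col_mul_pauli_col hL 1 (by decide), neg_mul, trace_neg, ← mul_assoc,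
        trace_pauli_mul_four]
      simp only [dotProduct_col_of_lorentz hL, hdet]
      simp [Gmat])
  have hu : IsUnit M.det := by simp [hM]
  have hr := mul_nonsing_inv M hu
  have hconj : ∀ i, pauli (Λ.col i) * (pauli (Λ.col 0)).adjugate * M = M * pauliBasis i →
      pauli (Λ.col i) = M * pauliBasis i * (M⁻¹ * pauli (Λ.col 0)) := fun i hi => by
    rw [← hi, mul_assoc _ M, ← mul_assoc M, hr, one_mul, mul_assoc, h0, mul_one]
  obtain ⟨H, hH⟩ : ∃ H, M⁻¹ * pauli (Λ.col 0) = H * Mᴴ :=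
    ⟨M⁻¹ * pauli (Λ.col 0) * (M⁻¹)ᴴ, by
      rw [mul_assoc, ← conjTranspose_mul, hr, conjTranspose_one, mul_one]⟩
  have hA0 : pauli (Λ.col 0) = M * H * Mᴴ := by
    rw [mul_assoc, ← hH, ← mul_assoc, hr, one_mul]
  have hHH : Hᴴ = H := eq_of_conj_eq hM <| by
    rw [← hA0, ← conjTranspose_pauli, hA0]; simp [mul_assoc]
  have hcomm : ∀ i, pauli (Λ.col i) * (pauli (Λ.col 0)).adjugate * M = M * pauliBasis i →
      H * pauliBasis i = pauliBasis i * H := fun i hi => eq_of_conj_eq hM <| by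
    have e := hconj i hi
    rw [hH] at e
    have e' := congrArg conjTranspose e
    rw [conjTranspose_pauli] at e'
    have hs : (pauliBasis i)ᴴ = pauliBasis i := conjTranspose_pauli _
    simp only [conjTranspose_mul, conjTranspose_conjTranspose, hs, hHH] at e'
    simpa only [mul_assoc] using e'.symm.trans e
  have hHs := eq_smul_one_of_commute (hcomm 1 h1) (hcomm 3 h3)
  have hc : H 0 0 = 1 := eq_one_of_smul_mul_conjTranspose hM (x := Λ.col 0) h00
    (det_pauli_col_zero hL) (by rw [hA0, hHs]; simp)
  rw [hc, one_smul] at hHs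
  rw [hHs, one_mul] at hH
  rw [hH] at hconj
  refine ⟨M, hM, fun i => ?_⟩
  fin_cases i
  · simpa [hHs, pauliBasis_zero] using hA0
  · exact hconj 1 h1
  · exact hconj 2 h2
  · exact hconj 3 h3

/-- Uniqueness up to sign of the spinor representative. -/
lemma eq_or_eq_neg_of_conj_eq {M N : Matrix (Fin 2) (Fin 2) ℂ} (hM : M.det = 1)
    (hN : N.det = 1) (h : ∀ i, N * pauliBasis i * Nᴴ = M * pauliBasis i * Mᴴ) :
    N = M ∨ N = -M := by
  have hr := mul_nonsing_inv M (by simp [hM])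
  obtain ⟨D, rfl⟩ : ∃ D, N = M * D := ⟨M⁻¹ * N, by rw [← mul_assoc, hr, one_mul]⟩
  have hD : ∀ i, D * pauliBasis i * Dᴴ = pauliBasis i := fun i => by
    refine eq_of_conj_eq hM ?_
    simpa only [conjTranspose_mul, mul_assoc] using h i
  have hD0 : Dᴴ * D = 1 := by
    have := hD 0
    rw [pauliBasis_zero, mul_one] at this
    exact mul_eq_one_comm.1 this
  have hcomm : ∀ i, D * pauliBasis i = pauliBasis i * D := fun i => by
    conv_rhs => rw [← hD i]
    rw [mul_assoc _ Dᴴ, hD0, mul_one]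
  have hs := eq_smul_one_of_commute (hcomm 1) (hcomm 3)
  have hsq : D 0 0 ^ 2 = 1 := by
    rw [det_mul, hM, one_mul, hs] at hN
    simpa [det_smul] using hN
  rcases eq_or_eq_neg_of_sq_eq_sq _ _ (hsq.trans (one_pow 2).symm) with h1 | h1
  · left; rw [hs, h1]; simp
  · right; rw [hs, h1]; simp

/-- Every proper Lorentz matrix `Λ` is represented as a jaws operator in the Pauli
coding: there is `M ∈ SL(2,ℂ)` with `σ(Λx) = M σ(x) M*` for all `x ∈ ℝ⁴`, and `M` is
unique up to sign. -/
theorem properLorentz_jaws_representation (Λ : Matrix (Fin 4) (Fin 4) ℝ)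
    (hL : Λᵀ * Gmat * Λ = Gmat) (hdet : Λ.det = 1) (h00 : 0 < Λ 0 0) :
    ∃ M : Matrix (Fin 2) (Fin 2) ℂ, M.det = 1 ∧
      (∀ x : Fin 4 → ℝ, pauli (Λ.mulVec x) = M * pauli x * Mᴴ) ∧
      ∀ M' : Matrix (Fin 2) (Fin 2) ℂ, M'.det = 1 →
        (∀ x : Fin 4 → ℝ, pauli (Λ.mulVec x) = M' * pauli x * M'ᴴ) →
        M' = M ∨ M' = -M := by
  obtain ⟨M, hM, hMA⟩ := exists_conj_of_lorentz hL hdet h00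
  refine ⟨M, hM, fun x => ?_, fun N hN hNA => eq_or_eq_neg_of_conj_eq hM hN fun i => ?_⟩
  · simp [pauli_mulVec, pauli_eq_sum x, hMA, Matrix.mul_sum, Matrix.sum_mul]
  · rw [← hMA, pauliBasis, ← hNA, mulVec_single_one]
end
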